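/- Fix κ ∈ (0,1), q ∈ [0,1], w > 0, and a finite Borel measure μ on [0,1] having a continuous, everywhere positive density with respect to Lebesgue measure. If (f*,a*) and (f⋄,a⋄) are both pure-strategy Nash equilibria, then f* = f⋄ μ-almost everywhere and a* = a⋄. -/

import Mathlib

open MeasureTheory Set

noncomputable section

/-- `μ` is a finite Borel measure on `[0,1]` with a continuous, everywhere positive
density with respect to Lebesgue measure. -/
def NiceDensity (μ : Measure ℝ) : Prop :=
  ∃ g : ℝ → ℝ, ContinuousOn g (Icc 0 1) ∧ (∀ p ∈ Icc (0:ℝ) 1, 0 < g p) ∧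
    μ = (volume.restrict (Icc (0:ℝ) 1)).withDensity (fun p => ENNReal.ofReal (g p))

/-- Total amount wagered by the diffuse players on Outcome 1. -/
def d1 (μ : Measure ℝ) (f : ℝ → ℝ × ℝ) : ℝ := ∫ p in Icc (0:ℝ) 1, (f p).1 ∂μ

/-- Total amount wagered by the diffuse players on Outcome 2. -/
def d2 (μ : Measure ℝ) (f : ℝ → ℝ × ℝ) : ℝ := ∫ p in Icc (0:ℝ) 1, (f p).2 ∂μ

/-- The implied probability of Outcome 1, `P^{f,a}`. -/
def impliedProb (μ : Measure ℝ) (f : ℝ → ℝ × ℝ) (a : ℝ × ℝ) : ℝ :=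
  (d1 μ f + a.1) / (d1 μ f + d2 μ f + a.1 + a.2)

/-- A feasible strategy profile for the diffuse players. -/
def FeasibleDiffuse (f : ℝ → ℝ × ℝ) : Prop :=
  Measurable f ∧ ∀ p ∈ Icc (0:ℝ) 1, 0 ≤ (f p).1 ∧ 0 ≤ (f p).2 ∧ (f p).1 + (f p).2 ≤ 1

/-- A feasible strategy profile for the atomic player. -/
def FeasibleAtomic (w : ℝ) (a : ℝ × ℝ) : Prop := 0 ≤ a.1 ∧ 0 ≤ a.2 ∧ a.1 + a.2 ≤ w

/-- The expected profit of a bettor who believes Outcome 1 occurs with probability `p`,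
betting `b1` on Outcome 1 and `b2` on Outcome 2, when the implied probability of
Outcome 1 is `P` (with the indicator conventions of the paper). -/
def payoff (κ P p b1 b2 : ℝ) : ℝ :=
  b1 * ((if P = 0 then 0 else κ * p / P) - 1) +
  b2 * ((if P = 1 then 0 else κ * (1 - p) / (1 - P)) - 1)

/-- A pure-strategy Nash equilibrium. -/
def IsEquilibrium (κ q w : ℝ) (μ : Measure ℝ) (f : ℝ → ℝ × ℝ) (a : ℝ × ℝ) : Prop :=
  FeasibleDiffuse f ∧ FeasibleAtomic w a ∧
  0 < d1 μ f + d2 μ f + a.1 + a.2 ∧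
  (∀ p ∈ Icc (0:ℝ) 1,
    payoff κ (impliedProb μ f a) p (f p).1 (f p).2 =
      sSup {x | ∃ b1 b2 : ℝ, 0 ≤ b1 ∧ 0 ≤ b2 ∧ b1 + b2 ≤ 1 ∧
        x = payoff κ (impliedProb μ f a) p b1 b2}) ∧
  payoff κ (impliedProb μ f a) q a.1 a.2 =
    sSup {x | ∃ b1 b2 : ℝ, 0 ≤ b1 ∧ 0 ≤ b2 ∧ b1 + b2 ≤ w ∧
      0 < d1 μ f + d2 μ f + b1 + b2 ∧
      x = payoff κ (impliedProb μ f (b1, b2)) q b1 b2}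

/-- optimality of the diffuse players, without suprema -/
lemma aux_diffuse {κ q w : ℝ} {μ : Measure ℝ} {f : ℝ → ℝ × ℝ} {a : ℝ × ℝ}
    (h : IsEquilibrium κ q w μ f a) (p : ℝ) (hp : p ∈ Icc (0:ℝ) 1) (b1 b2 : ℝ)
    (h1 : 0 ≤ b1) (h2 : 0 ≤ b2) (h12 : b1 + b2 ≤ 1) :
    payoff κ (impliedProb μ f a) p b1 b2 ≤ payoff κ (impliedProb μ f a) p (f p).1 (f p).2 := by
  rw [h.2.2.2.1 p hp]
  apply le_csSup
  · unfold payoff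
    generalize ((if impliedProb μ f a = 0 then 0 else κ * p / impliedProb μ f a) - 1) = s
    generalize ((if impliedProb μ f a = 1 then 0 else
      κ * (1 - p) / (1 - impliedProb μ f a)) - 1) = t
    refine ⟨|s| + |t|, ?_⟩
    rintro x ⟨c1, c2, hc1, hc2, hc, rfl⟩
    have e1 : c1 * s ≤ 1 * |s| :=
      (mul_le_mul_of_nonneg_left (le_abs_self s) hc1).trans
        (mul_le_mul_of_nonneg_right (by linarith) (abs_nonneg s))
    have e2 : c2 * t ≤ 1 * |t| :=
      (mul_le_mul_of_nonneg_left (le_abs_self t) hc2).trans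
        (mul_le_mul_of_nonneg_right (by linarith) (abs_nonneg t))
    linarith
  · exact ⟨b1, b2, h1, h2, h12, rfl⟩

lemma aux_bound {d b T c : ℝ} (hd : 0 ≤ d) (hb : 0 ≤ b) (hT : 0 < T) (hc : 0 ≤ c) :
    b * ((if (d + b) / T = 0 then 0 else c / ((d + b) / T)) - 1) ≤ T * c := by
  split_ifs with h
  · nlinarith [mul_nonneg hT.le hc]
  · have hne : d + b ≠ 0 := by
      intro h0; apply h; rw [h0]; simp
    have hpos : 0 < d + b := lt_of_le_of_ne (by linarith) (Ne.symm hne)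
    have e : b * (c / ((d + b) / T)) = (T * c) * (b / (d + b)) := by
      field_simp
    have e2 : b / (d + b) ≤ 1 := by
      rw [div_le_one hpos]; linarith
    have := mul_le_mul_of_nonneg_left e2 (mul_nonneg hT.le hc)
    rw [mul_sub, e]; linarith

lemma aux_one_sub {x y T : ℝ} (hT : T ≠ 0) (h : x + y = T) : 1 - x / T = y / T := by
  subst h; field_simp; ring

/-- payoff in symmetric form -/
lemma aux_payoff (κ q : ℝ) {x y T : ℝ} (hT : T ≠ 0) (h : x + y = T) (b1 b2 : ℝ) :
    payoff κ (x / T) q b1 b2 =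
      b1 * ((if x / T = 0 then 0 else (κ * q) / (x / T)) - 1) +
      b2 * ((if y / T = 0 then 0 else (κ * (1 - q)) / (y / T)) - 1) := by
  have e := aux_one_sub hT h
  have e3 : (x / T = 1) ↔ (y / T = 0) := by
    rw [← e]; constructor <;> intro h <;> linarith
  unfold payoff
  simp only [e, e3]

/-- optimality of the atomic player, without suprema -/
lemma aux_atomic {κ q w : ℝ} {μ : Measure ℝ} {f : ℝ → ℝ × ℝ} {a : ℝ × ℝ}
    (hκ : κ ∈ Ioo (0:ℝ) 1) (hq : q ∈ Icc (0:ℝ) 1)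
    (h : IsEquilibrium κ q w μ f a) (hd1 : 0 ≤ d1 μ f) (hd2 : 0 ≤ d2 μ f) (b1 b2 : ℝ)
    (h1 : 0 ≤ b1) (h2 : 0 ≤ b2) (h12 : b1 + b2 ≤ w) (hb : 0 < d1 μ f + d2 μ f + b1 + b2) :
    payoff κ (impliedProb μ f (b1, b2)) q b1 b2 ≤ payoff κ (impliedProb μ f a) q a.1 a.2 := by
  rw [h.2.2.2.2]
  apply le_csSup
  · refine ⟨(d1 μ f + d2 μ f + w) * (κ * q) + (d1 μ f + d2 μ f + w) * (κ * (1 - q)), ?_⟩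
    rintro x ⟨c1, c2, hc1, hc2, hc, hT, rfl⟩
    have k1 : 0 ≤ κ * q := mul_nonneg hκ.1.le hq.1
    have k2 : 0 ≤ κ * (1 - q) := mul_nonneg hκ.1.le (by linarith [hq.2])
    unfold impliedProb
    rw [aux_payoff κ q (y := d2 μ f + c2) hT.ne' (by simp; ring)]
    have e1 := aux_bound hd1 hc1 hT k1
    have e2 := aux_bound hd2 hc2 hT k2
    have e3 := mul_le_mul_of_nonneg_right
      (show d1 μ f + d2 μ f + c1 + c2 ≤ d1 μ f + d2 μ f + w by linarith) k1
    have e4 := mul_le_mul_of_nonneg_right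
      (show d1 μ f + d2 μ f + c1 + c2 ≤ d1 μ f + d2 μ f + w by linarith) k2
    simp only at e1 e2 ⊢
    linarith
  · exact ⟨b1, b2, h1, h2, h12, hb, rfl⟩

/-- real-number summary of an equilibrium -/
structure Core (κ q w d e a b : ℝ) : Prop where
  hd : 0 ≤ d
  he : 0 ≤ e
  ha : 0 ≤ a
  hb : 0 ≤ b
  hw : a + b ≤ w
  hx : 0 < d + a
  hy : 0 < e + b
  hab : a = 0 ∨ b = 0
  h1 : 0 < a → d + a ≤ κ * q * (d + e + a + b)
  h2 : 0 < b → e + b ≤ κ * (1 - q) * (d + e + a + b)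
  m1 : b = 0 → ∀ c, 0 < c → c ≤ w →
    0 ≤ (a - c) * (κ * q * (1 + d * e / ((d + a) * (d + c))) - 1)
  m2 : a = 0 → ∀ c, 0 < c → c ≤ w →
    0 ≤ (b - c) * (κ * (1 - q) * (1 + e * d / ((e + b) * (e + c))) - 1)

lemma Core.swap {κ q w d e a b : ℝ} (h : Core κ q w d e a b) : Core κ (1 - q) w e d b a where
  hd := h.he
  he := h.hd
  ha := h.hb
  hb := h.ha
  hw := by linarith [h.hw]
  hx := h.hy
  hy := h.hx
  hab := h.hab.symm
  h1 := fun hh => by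
    have := h.h2 hh
    rwa [show d + e + a + b = e + d + b + a by ring] at this
  h2 := fun hh => by
    have := h.h1 hh
    rwa [show d + e + a + b = e + d + b + a by ring, show q = 1 - (1 - q) by ring] at this
  m1 := h.m2
  m2 := fun hh c => by
    have := h.m1 hh c
    rwa [show q = 1 - (1 - q) by ring] at this

lemma aux_gain {k d e a c : ℝ} (h1 : d + a ≠ 0) (h2 : d + c ≠ 0) :
    a * (k * (d + e + a) / (d + a) - 1) - c * (k * (d + e + c) / (d + c) - 1) =
      (a - c) * (k * (1 + d * e / ((d + a) * (d + c))) - 1) := by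
  field_simp
  ring

/-- the case where the atomic player bets more on outcome 1 at the larger price -/
lemma core_half {κ q w d e a b d' e' a' b' : ℝ} (hκ : κ ∈ Ioo (0:ℝ) 1) (hq : q ∈ Icc (0:ℝ) 1)
    (h : Core κ q w d e a b) (h' : Core κ q w d' e' a' b') (hdd : d' ≤ d)
    (hP : (d + a) * (e' + b') < (d' + a') * (e + b)) (haa : a < a') : False := by
  have ha := h.ha
  have ha' : 0 < a' := by linarith
  have hb' : b' = 0 := by
    rcases h'.hab with h0 | h0
    · linarith
    · exact h0
  subst hb'
  rcases h.hb.eq_or_lt with h0 | h0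
  · -- both on outcome 1
    subst h0
    obtain ⟨c, hc1, hc2⟩ := exists_between haa
    have hw' := h'.hw
    have i1 := h.m1 rfl c (by linarith) (by linarith)
    have i2 := h'.m1 rfl c (by linarith) (by linarith)
    have j1 : κ * q * (1 + d * e / ((d + a) * (d + c))) - 1 ≤ 0 := by
      by_contra hh
      push Not at hh
      nlinarith
    have j2 : 0 ≤ κ * q * (1 + d' * e' / ((d' + a') * (d' + c))) - 1 := by
      by_contra hh
      push Not at hh
      nlinarith
    have hd := h.hd
    have hd' := h'.hd
    have x1 := h.hx
    have x2 := h'.hx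
    have y1 := h.hy
    have y2 := h'.hy
    have z1 : 0 < d + c := by linarith
    have z2 : 0 < d' + c := by linarith
    have kq : κ * q < 1 := by nlinarith [hκ.1, hκ.2, hq.1, hq.2]
    have kq0 : 0 ≤ κ * q := mul_nonneg hκ.1.le hq.1
    have hd'pos : 0 < d' := by
      rcases hd'.eq_or_lt with h0 | h0
      · rw [← h0] at j2; simp at j2; linarith
      · exact h0
    have kqpos : 0 < κ * q := by
      rcases kq0.eq_or_lt with h0 | h0
      · rw [← h0] at j2; simp at j2; linarith
      · exact h0
    have r1 : d' * e' / ((d' + a') * (d' + c)) < d * e / ((d + a) * (d + c)) := by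
      rw [mul_comm d' e', mul_comm d e, mul_div_mul_comm, mul_div_mul_comm]
      have s1 : e' / (d' + a') < e / (d + a) := by
        rw [div_lt_div_iff₀ x2 x1]; linarith
      have s2 : d' / (d' + c) ≤ d / (d + c) := by
        rw [div_le_div_iff₀ z2 z1]; nlinarith
      have s3 : 0 < d' / (d' + c) := by positivity
      have s4 : 0 ≤ e / (d + a) := div_nonneg h.he x1.le
      calc _ < e / (d + a) * (d' / (d' + c)) := mul_lt_mul_of_pos_right s1 s3
        _ ≤ _ := mul_le_mul_of_nonneg_left s2 s4
    nlinarith [mul_lt_mul_of_pos_left r1 kqpos]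
  · -- on opposite outcomes
    have i1 := h.h2 h0
    have i2 := h'.h1 ha'
    have x1 := h.hx
    have x2 := h'.hx
    have y1 := h.hy
    have y2 := h'.hy
    have T1 : 0 < d + e + a + b := by linarith
    have T2 : 0 < d' + e' + a' + 0 := by linarith
    have l1 : (e + b) / (d + e + a + b) ≤ κ * (1 - q) := by rwa [div_le_iff₀ T1]
    have l2 : (d' + a') / (d' + e' + a' + 0) ≤ κ * q := by rwa [div_le_iff₀ T2]
    have l3 : (d + a) / (d + e + a + b) < (d' + a') / (d' + e' + a' + 0) := by
      rw [div_lt_div_iff₀ T1 T2]; nlinarith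
    have l4 : (d + a) / (d + e + a + b) + (e + b) / (d + e + a + b) = 1 := by
      field_simp; ring
    nlinarith [hκ.2]

lemma core_main {κ q w d e a b d' e' a' b' : ℝ} (hκ : κ ∈ Ioo (0:ℝ) 1) (hq : q ∈ Icc (0:ℝ) 1)
    (h : Core κ q w d e a b) (h' : Core κ q w d' e' a' b') (hdd : d' ≤ d) (hee : e ≤ e')
    (hP : (d + a) / (d + e + a + b) < (d' + a') / (d' + e' + a' + b')) : False := by
  have x1 := h.hx
  have x2 := h'.hx
  have y1 := h.hy
  have y2 := h'.hy
  rw [div_lt_div_iff₀ (by linarith) (by linarith)] at hP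
  have hP' : (d + a) * (e' + b') < (d' + a') * (e + b) := by nlinarith
  rcases lt_or_ge a a' with c | c
  · exact core_half hκ hq h h' hdd hP' c
  rcases lt_or_ge b' b with c2 | c2
  · exact core_half hκ ⟨by linarith [hq.2], by linarith [hq.1]⟩ h'.swap h.swap hee
      (by linarith) c2
  have : (d' + a') * (e + b) ≤ (d + a) * (e' + b') :=
    mul_le_mul (by linarith) (by linarith) y1.le x1.le
  linarith

lemma core_same {κ q w d e a b a' b' : ℝ} (h : Core κ q w d e a b) (h' : Core κ q w d e a' b')
    (hP : (d + a) / (d + e + a + b) = (d + a') / (d + e + a' + b')) : a = a' ∧ b = b' := by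
  have x1 := h.hx
  have x2 := h'.hx
  have y1 := h.hy
  have y2 := h'.hy
  have a1 := h.ha
  have a2 := h'.ha
  have b1 := h.hb
  have b2 := h'.hb
  rw [div_eq_div_iff (by linarith) (by linarith)] at hP
  have hP' : (d + a) * (e + b') = (d + a') * (e + b) := by linarith
  -- `(a - a') (e + b) = (b - b') (d + a)`
  have key : (a - a') * (e + b) = (b - b') * (d + a) := by linarith
  rcases lt_trichotomy a a' with c | c | c
  · have : b < b' := by
      by_contra hh; push Not at hh
      nlinarith
    rcases h'.hab with h0 | h0 <;> exfalso <;> linarith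
  · refine ⟨c, ?_⟩
    rw [c, sub_self, zero_mul] at key
    rcases mul_eq_zero.1 key.symm with h0 | h0 <;> linarith
  · have : b' < b := by
      by_contra hh; push Not at hh
      nlinarith
    rcases h.hab with h0 | h0 <;> exfalso <;> linarith

lemma nice_finite {μ : Measure ℝ} (hμ : NiceDensity μ) : IsFiniteMeasure μ := by
  obtain ⟨g, hg, -, rfl⟩ := hμ
  exact isFiniteMeasure_withDensity_ofReal hg.integrableOn_Icc.2

lemma nice_ac {μ : Measure ℝ} (hμ : NiceDensity μ) :
    μ ≪ volume.restrict (Icc (0:ℝ) 1) := by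
  obtain ⟨g, hg, -, rfl⟩ := hμ
  exact withDensity_absolutelyContinuous _ _

lemma d1_nonneg {μ : Measure ℝ} {f : ℝ → ℝ × ℝ} (hf : FeasibleDiffuse f) : 0 ≤ d1 μ f :=
  setIntegral_nonneg measurableSet_Icc fun p hp => (hf.2 p hp).1

lemma d2_nonneg {μ : Measure ℝ} {f : ℝ → ℝ × ℝ} (hf : FeasibleDiffuse f) : 0 ≤ d2 μ f :=
  setIntegral_nonneg measurableSet_Icc fun p hp => (hf.2 p hp).2.1

lemma f1_int {μ : Measure ℝ} [IsFiniteMeasure μ] {f : ℝ → ℝ × ℝ} (hf : FeasibleDiffuse f) :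
    IntegrableOn (fun p => (f p).1) (Icc 0 1) μ := by
  apply Measure.integrableOn_of_bounded (M := 1) (measure_ne_top _ _)
    (hf.1.fst.aestronglyMeasurable)
  filter_upwards [ae_restrict_mem measurableSet_Icc] with p hp
  obtain ⟨h1, h2, h3⟩ := hf.2 p hp
  rw [Real.norm_eq_abs, abs_of_nonneg h1]; linarith

lemma f2_int {μ : Measure ℝ} [IsFiniteMeasure μ] {f : ℝ → ℝ × ℝ} (hf : FeasibleDiffuse f) :
    IntegrableOn (fun p => (f p).2) (Icc 0 1) μ := by
  apply Measure.integrableOn_of_bounded (M := 1) (measure_ne_top _ _)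
    (hf.1.snd.aestronglyMeasurable)
  filter_upwards [ae_restrict_mem measurableSet_Icc] with p hp
  obtain ⟨h1, h2, h3⟩ := hf.2 p hp
  rw [Real.norm_eq_abs, abs_of_nonneg h2]; linarith

/-- the diffuse players bet a positive amount -/
lemma D_pos {κ q w : ℝ} {μ : Measure ℝ} {f : ℝ → ℝ × ℝ} {a : ℝ × ℝ}
    (hκ : κ ∈ Ioo (0:ℝ) 1) (hq : q ∈ Icc (0:ℝ) 1)
    (h : IsEquilibrium κ q w μ f a) : 0 < d1 μ f + d2 μ f := by
  have hd1 : 0 ≤ d1 μ f := d1_nonneg h.1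
  have hd2 : 0 ≤ d2 μ f := d2_nonneg h.1
  by_contra hh
  have z1 : d1 μ f = 0 := by linarith
  have z2 : d2 μ f = 0 := by linarith
  obtain ⟨ha1, ha2, haw⟩ := h.2.1
  have hT := h.2.2.1
  have key := aux_atomic hκ hq h hd1 hd2 (a.1 / 2) (a.2 / 2) (by linarith) (by linarith)
    (by linarith) (by linarith)
  unfold impliedProb at key
  simp only [z1, z2, zero_add] at key hT
  have e : a.1 / 2 / (a.1 / 2 + a.2 / 2) = a.1 / (a.1 + a.2) := by
    field_simp
  rw [e, aux_payoff κ q hT.ne' rfl, aux_payoff κ q hT.ne' rfl] at key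
  have b1 : a.1 * ((if a.1 / (a.1 + a.2) = 0 then 0 else (κ * q) / (a.1 / (a.1 + a.2))) - 1)
      ≤ κ * q * (a.1 + a.2) - a.1 := by
    have := mul_nonneg (mul_nonneg hκ.1.le hq.1) hT.le
    split_ifs with h0
    · linarith
    · have : a.1 ≠ 0 := fun h1 => h0 (by rw [h1]; simp)
      apply le_of_eq; field_simp
  have b2 : a.2 * ((if a.2 / (a.1 + a.2) = 0 then 0 else
      (κ * (1 - q)) / (a.2 / (a.1 + a.2))) - 1)
      ≤ κ * (1 - q) * (a.1 + a.2) - a.2 := by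
    have := mul_nonneg (mul_nonneg hκ.1.le (show 0 ≤ 1 - q by linarith [hq.2])) hT.le
    split_ifs with h0
    · linarith
    · have : a.2 ≠ 0 := fun h1 => h0 (by rw [h1]; simp)
      apply le_of_eq; field_simp
  nlinarith [hκ.2]

lemma xy_pos {κ q w : ℝ} {μ : Measure ℝ} {f : ℝ → ℝ × ℝ} {a : ℝ × ℝ}
    (hκ : κ ∈ Ioo (0:ℝ) 1) (hq : q ∈ Icc (0:ℝ) 1)
    (h : IsEquilibrium κ q w μ f a) : 0 < d1 μ f + a.1 ∧ 0 < d2 μ f + a.2 := by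
  have hd1 : 0 ≤ d1 μ f := d1_nonneg h.1
  have hd2 : 0 ≤ d2 μ f := d2_nonneg h.1
  obtain ⟨ha1, ha2, haw⟩ := h.2.1
  have hT := h.2.2.1
  have hD := D_pos hκ hq h
  have hz1 : (∀ p ∈ Icc (0:ℝ) 1, (f p).1 = 0) → d1 μ f = 0 := fun hf =>
    setIntegral_eq_zero_of_forall_eq_zero hf
  have hz2 : (∀ p ∈ Icc (0:ℝ) 1, (f p).2 = 0) → d2 μ f = 0 := fun hf =>
    setIntegral_eq_zero_of_forall_eq_zero hf
  constructor
  · by_contra hh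
    have z1 : d1 μ f = 0 := by linarith
    have z2 : a.1 = 0 := by linarith
    have hP : impliedProb μ f a = 0 := by unfold impliedProb; rw [z1, z2]; simp
    have := hz2 fun p hp => by
      have := aux_diffuse h p hp 0 0 le_rfl le_rfl (by norm_num)
      obtain ⟨i1, i2, i3⟩ := h.1.2 p hp
      rw [hP] at this
      simp [payoff] at this
      have k : κ * (1 - p) < 1 := by nlinarith [hκ.1, hκ.2, hp.1, hp.2]
      nlinarith
    linarith
  · by_contra hh
    have z1 : d2 μ f = 0 := by linarith
    have z2 : a.2 = 0 := by linarith
    have hP : impliedProb μ f a = 1 := by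
      unfold impliedProb; rw [z1, z2] at hT ⊢
      rw [div_eq_one_iff_eq hT.ne']; ring
    have := hz1 fun p hp => by
      have := aux_diffuse h p hp 0 0 le_rfl le_rfl (by norm_num)
      obtain ⟨i1, i2, i3⟩ := h.1.2 p hp
      rw [hP] at this
      simp [payoff] at this
      have k : κ * p < 1 := by nlinarith [hκ.1, hκ.2, hp.1, hp.2]
      nlinarith
    linarith

lemma payoff_pos (κ q : ℝ) {x y T : ℝ} (hx : 0 < x) (hy : 0 < y) (h : x + y = T) (b1 b2 : ℝ) :
    payoff κ (x / T) q b1 b2 = b1 * (κ * q * T / x - 1) + b2 * (κ * (1 - q) * T / y - 1) := by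
  have hT : 0 < T := by linarith
  rw [aux_payoff κ q hT.ne' h, if_neg (by positivity), if_neg (by positivity)]
  simp only [div_div_eq_mul_div]

lemma eq_core {κ q w : ℝ} {μ : Measure ℝ} {f : ℝ → ℝ × ℝ} {a : ℝ × ℝ}
    (hκ : κ ∈ Ioo (0:ℝ) 1) (hq : q ∈ Icc (0:ℝ) 1)
    (h : IsEquilibrium κ q w μ f a) : Core κ q w (d1 μ f) (d2 μ f) a.1 a.2 := by
  have hd1 : 0 ≤ d1 μ f := d1_nonneg h.1
  have hd2 : 0 ≤ d2 μ f := d2_nonneg h.1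
  obtain ⟨ha1, ha2, haw⟩ := h.2.1
  have hT := h.2.2.1
  have hD := D_pos hκ hq h
  obtain ⟨hx, hy⟩ := xy_pos hκ hq h
  have opt := aux_atomic hκ hq h hd1 hd2
  unfold impliedProb at opt
  simp only at opt
  rw [payoff_pos κ q hx hy (by ring)] at opt
  generalize d1 μ f = d at *
  generalize d2 μ f = e at *
  obtain ⟨a, b⟩ := a
  simp only at *
  have hab : a = 0 ∨ b = 0 := by
    by_contra hh
    push Not at hh
    have pa : 0 < a := lt_of_le_of_ne ha1 (Ne.symm hh.1)
    have pb : 0 < b := lt_of_le_of_ne ha2 (Ne.symm hh.2)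
    set T := d + e + a + b with hTd
    obtain ⟨t, t0, t1, t2⟩ : ∃ t, 0 < t ∧ t < a ∧ t < b :=
      ⟨min a b / 2, by positivity, by linarith [min_le_left a b, lt_min pa pb],
        by linarith [min_le_right a b, lt_min pa pb]⟩
    have P0 : 0 < (d + a) / T := by positivity
    have Q0 : 0 < (e + b) / T := by positivity
    have PQ : (d + a) / T + (e + b) / T = 1 := by
      rw [← add_div, div_eq_one_iff_eq hT.ne']; ring
    have g1 : t * ((d + a) / T) ≤ t := by nlinarith
    have g2 : t * ((e + b) / T) ≤ t := by nlinarith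
    have g3 : t * ((d + a) / T) + t * ((e + b) / T) = t := by rw [← mul_add, PQ, mul_one]
    have gx : 0 < t * ((d + a) / T) := by positivity
    have gy : 0 < t * ((e + b) / T) := by positivity
    have key := opt (a - t * ((d + a) / T)) (b - t * ((e + b) / T)) (by linarith) (by linarith)
      (by linarith) (by linarith)
    have eP : (d + (a - t * ((d + a) / T))) /
        (d + e + (a - t * ((d + a) / T)) + (b - t * ((e + b) / T))) = (d + a) / T := by
      rw [show d + e + (a - t * ((d + a) / T)) + (b - t * ((e + b) / T)) = T - t by linarith]
      have : T - t ≠ 0 := by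
        have : 0 < T - t := by linarith
        exact this.ne'
      field_simp
      ring
    rw [eP, payoff_pos κ q hx hy (by ring)] at key
    have r : t * ((d + a) / T) * (κ * q * T / (d + a) - 1) +
        t * ((e + b) / T) * (κ * (1 - q) * T / (e + b) - 1) = t * κ - t := by
      have r1 : t * ((d + a) / T) * (κ * q * T / (d + a)) = t * κ * q := by field_simp
      have r2 : t * ((e + b) / T) * (κ * (1 - q) * T / (e + b)) = t * κ * (1 - q) := by field_simp
      linarith
    nlinarith [hκ.2]
  have opt0 := opt 0 0 le_rfl le_rfl (by linarith) (by linarith)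
  simp only [payoff, zero_mul, add_zero] at opt0
  refine ⟨hd1, hd2, ha1, ha2, haw, hx, hy, hab, ?_, ?_, ?_, ?_⟩
  · intro pa
    have hb : b = 0 := hab.resolve_left pa.ne'
    subst hb
    rw [zero_mul, add_zero] at opt0
    have := nonneg_of_mul_nonneg_right opt0 pa
    have : 1 ≤ κ * q * (d + e + a + 0) / (d + a) := by linarith
    rwa [one_le_div hx] at this
  · intro pb
    have ha : a = 0 := hab.resolve_right pb.ne'
    subst ha
    rw [zero_mul, zero_add] at opt0
    have := nonneg_of_mul_nonneg_right opt0 pb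
    have : 1 ≤ κ * (1 - q) * (d + e + 0 + b) / (e + b) := by linarith
    rwa [one_le_div hy] at this
  · intro hb c hc hcw
    subst hb
    have := opt c 0 hc.le le_rfl (by linarith) (by linarith)
    rw [payoff_pos κ q (y := e + 0) (by linarith) hy (by ring)] at this
    have hc' : d + c ≠ 0 := by positivity
    have g := aux_gain (k := κ * q) (e := e) hx.ne' hc'
    simp only [add_zero, zero_mul] at this
    linarith
  · intro ha c hc hcw
    subst ha
    have := opt 0 c le_rfl hc.le (by linarith) (by linarith)
    rw [payoff_pos κ q (y := e + c) hx (by linarith) (by ring)] at this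
    have hc' : e + c ≠ 0 := by positivity
    have g := aux_gain (k := κ * (1 - q)) (e := d) hy.ne' hc'
    simp only [add_zero, zero_mul, zero_add] at this
    rw [add_comm e d] at g
    linarith

/-- structure of the diffuse best responses -/
lemma diffuse_str {κ q w : ℝ} {μ : Measure ℝ} {f : ℝ → ℝ × ℝ} {a : ℝ × ℝ}
    (hκ : κ ∈ Ioo (0:ℝ) 1) (hq : q ∈ Icc (0:ℝ) 1)
    (h : IsEquilibrium κ q w μ f a) (p : ℝ) (hp : p ∈ Icc (0:ℝ) 1) :
    (impliedProb μ f a < κ * p → f p = (1, 0)) ∧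
    (1 - impliedProb μ f a < κ * (1 - p) → f p = (0, 1)) ∧
    (κ * p < impliedProb μ f a → (f p).1 = 0) ∧
    (κ * (1 - p) < 1 - impliedProb μ f a → (f p).2 = 0) := by
  obtain ⟨hx, hy⟩ := xy_pos hκ hq h
  have hT := h.2.2.1
  have P0 : 0 < impliedProb μ f a := div_pos hx hT
  have P1 : impliedProb μ f a < 1 := by
    unfold impliedProb; rw [div_lt_one hT]; linarith
  have opt := aux_diffuse h p hp
  obtain ⟨i1, i2, i3⟩ := h.1.2 p hp
  generalize impliedProb μ f a = P at *
  unfold payoff at opt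
  rw [if_neg P0.ne', if_neg P1.ne] at opt
  have Q0 : 0 < 1 - P := by linarith
  have s1 : κ * p < P ↔ κ * p / P - 1 < 0 := by rw [sub_neg, div_lt_one P0]
  have s2 : P < κ * p ↔ 0 < κ * p / P - 1 := by rw [sub_pos, one_lt_div P0]
  have t1 : κ * (1 - p) < 1 - P ↔ κ * (1 - p) / (1 - P) - 1 < 0 := by
    rw [sub_neg, div_lt_one Q0]
  have t2 : 1 - P < κ * (1 - p) ↔ 0 < κ * (1 - p) / (1 - P) - 1 := by
    rw [sub_pos, one_lt_div Q0]
  have c1 : P < κ * p → κ * (1 - p) < 1 - P := fun _ => by linarith [hκ.2]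
  have c2 : 1 - P < κ * (1 - p) → κ * p < P := fun _ => by linarith [hκ.2]
  rw [s1, s2, t1, t2] at *
  generalize κ * p / P - 1 = s at *
  generalize κ * (1 - p) / (1 - P) - 1 = t at *
  refine ⟨fun hs => ?_, fun ht => ?_, fun hs => ?_, fun ht => ?_⟩
  · have := opt 1 0 (by norm_num) le_rfl (by norm_num)
    have ht := c1 hs
    have e2 : (f p).2 = 0 := by
      by_contra hh
      have : 0 < (f p).2 := lt_of_le_of_ne i2 (Ne.symm hh)
      nlinarith
    rw [e2] at this i3
    have e1 : (f p).1 = 1 := by nlinarith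
    exact Prod.ext e1 e2
  · have := opt 0 1 le_rfl (by norm_num) (by norm_num)
    have hs := c2 ht
    have e1 : (f p).1 = 0 := by
      by_contra hh
      have : 0 < (f p).1 := lt_of_le_of_ne i1 (Ne.symm hh)
      nlinarith
    rw [e1] at this i3
    have e2 : (f p).2 = 1 := by nlinarith
    exact Prod.ext e1 e2
  · have := opt 0 (f p).2 le_rfl i2 (by linarith)
    by_contra hh
    have : 0 < (f p).1 := lt_of_le_of_ne i1 (Ne.symm hh)
    nlinarith
  · have := opt (f p).1 0 i1 le_rfl (by linarith)
    by_contra hh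
    have : 0 < (f p).2 := lt_of_le_of_ne i2 (Ne.symm hh)
    nlinarith

lemma not_lt_prob {κ q w : ℝ} {μ : Measure ℝ} (hμ : NiceDensity μ)
    {f f' : ℝ → ℝ × ℝ} {a a' : ℝ × ℝ}
    (hκ : κ ∈ Ioo (0:ℝ) 1) (hq : q ∈ Icc (0:ℝ) 1)
    (h : IsEquilibrium κ q w μ f a) (h' : IsEquilibrium κ q w μ f' a') :
    ¬ impliedProb μ f a < impliedProb μ f' a' := by
  intro hP
  haveI := nice_finite hμ
  refine core_main hκ hq (eq_core hκ hq h) (eq_core hκ hq h') ?_ ?_ hP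
  · refine setIntegral_mono_on (f1_int h'.1) (f1_int h.1) measurableSet_Icc fun p hp => ?_
    obtain ⟨u1, -, -, -⟩ := diffuse_str hκ hq h p hp
    obtain ⟨-, -, u3, -⟩ := diffuse_str hκ hq h' p hp
    obtain ⟨i1, i2, i3⟩ := h.1.2 p hp
    obtain ⟨j1, j2, j3⟩ := h'.1.2 p hp
    rcases lt_or_ge (κ * p) (impliedProb μ f' a') with c | c
    · rw [u3 c]; exact i1
    · rw [u1 (by linarith)]; simp only; linarith
  · refine setIntegral_mono_on (f2_int h.1) (f2_int h'.1) measurableSet_Icc fun p hp => ?_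
    obtain ⟨-, -, -, u4⟩ := diffuse_str hκ hq h p hp
    obtain ⟨-, u2, -, -⟩ := diffuse_str hκ hq h' p hp
    obtain ⟨i1, i2, i3⟩ := h.1.2 p hp
    obtain ⟨j1, j2, j3⟩ := h'.1.2 p hp
    rcases lt_or_ge (κ * (1 - p)) (1 - impliedProb μ f a) with c | c
    · rw [u4 c]; exact j2
    · rw [u2 (by linarith)]; simp only; linarith

/-- Theorem (uniqueness): any two pure-strategy Nash equilibria agree `μ`-a.e. in the
diffuse strategies and exactly in the atomic strategy. -/
theorem stmt_6 (κ q w : ℝ) (hκ : κ ∈ Ioo (0:ℝ) 1) (hq : q ∈ Icc (0:ℝ) 1) (hw : 0 < w)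
    (μ : Measure ℝ) (hμ : NiceDensity μ)
    (fs : ℝ → ℝ × ℝ) (as : ℝ × ℝ) (hs : IsEquilibrium κ q w μ fs as)
    (fd : ℝ → ℝ × ℝ) (ad : ℝ × ℝ) (hd : IsEquilibrium κ q w μ fd ad) :
    (∀ᵐ p ∂μ, fs p = fd p) ∧ as = ad := by
  have hP : impliedProb μ fs as = impliedProb μ fd ad :=
    le_antisymm (not_lt.1 (not_lt_prob hμ hκ hq hd hs)) (not_lt.1 (not_lt_prob hμ hκ hq hs hd))
  have hae : ∀ᵐ p ∂μ, p ∈ Icc (0:ℝ) 1 ∧ fs p = fd p := by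
    have n1 : ∀ᵐ p ∂(volume.restrict (Icc (0:ℝ) 1)), p ≠ impliedProb μ fs as / κ :=
      ae_restrict_of_ae (Measure.ae_ne volume _)
    have n2 : ∀ᵐ p ∂(volume.restrict (Icc (0:ℝ) 1)), p ≠ 1 - (1 - impliedProb μ fs as) / κ :=
      ae_restrict_of_ae (Measure.ae_ne volume _)
    have n3 := ae_restrict_mem (μ := (volume : Measure ℝ)) (measurableSet_Icc (a := (0:ℝ)) (b := 1))
    filter_upwards [(nice_ac hμ).ae_le n1, (nice_ac hμ).ae_le n2, (nice_ac hμ).ae_le n3]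
      with p m1 m2 hp
    refine ⟨hp, ?_⟩
    have m1' : κ * p ≠ impliedProb μ fs as := fun e => m1 (by
      rw [← e]; field_simp [hκ.1.ne'])
    have m2' : κ * (1 - p) ≠ 1 - impliedProb μ fs as := fun e => m2 (by
      rw [← e, mul_div_cancel_left₀ _ hκ.1.ne']; ring)
    obtain ⟨u1, u2, u3, u4⟩ := diffuse_str hκ hq hs p hp
    obtain ⟨v1, v2, v3, v4⟩ := diffuse_str hκ hq hd p hp
    rw [← hP] at v1 v2 v3 v4
    rcases lt_or_gt_of_ne m1' with c | c
    · rcases lt_or_gt_of_ne m2' with c' | c'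
      · exact Prod.ext (by rw [u3 c, v3 c]) (by rw [u4 c', v4 c'])
      · rw [u2 c', v2 c']
    · rw [u1 c, v1 c]
  have e1 : d1 μ fs = d1 μ fd :=
    integral_congr_ae (ae_restrict_of_ae (hae.mono fun p h => by simp only [h.2]))
  have e2 : d2 μ fs = d2 μ fd :=
    integral_congr_ae (ae_restrict_of_ae (hae.mono fun p h => by simp only [h.2]))
  refine ⟨hae.mono fun p h => h.2, ?_⟩
  have c1 := eq_core hκ hq hs
  have c2 := eq_core hκ hq hd
  unfold impliedProb at hP
  rw [e1, e2] at c1 hP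
  obtain ⟨r1, r2⟩ := core_same c1 c2 hP
  exact Prod.ext r1 r2
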